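/- The function y(x) = −x(b−1)(x²−b)² / [(x−b)(x⁴ − 4bx³ + 6bx² − 4bx + b²)] satisfies the Painlevé VI equation with parameters (α, β, γ, δ) = (9/2, 0, 0, 1/2). -/

import Mathlib

/-- The polynomial identity behind the statement, with the factorizations of y, y - 1, y - x. -/
theorem p6_alg (b x A B C D S G1 D1 : ℂ) (hb0 : b ≠ 0) (hb1 : b - 1 ≠ 0) (hx0 : x ≠ 0)
    (hx1 : x - 1 ≠ 0) (hA : A ≠ 0) (hB : B ≠ 0) (hC : C ≠ 0) (hD : D ≠ 0)
    (eA : A = x ^ 2 - b) (eB : B = x ^ 2 - 2 * x + b) (eC : C = x ^ 2 - 2 * b * x + b)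
    (eD : D = (x - b) * (x ^ 4 - 4 * b * x ^ 3 + 6 * b * x ^ 2 - 4 * b * x + b ^ 2))
    (eS : S = 5 * x ^ 4 - (8 * b + 6) * x ^ 3 + 12 * b * x ^ 2 - 2 * b * x - b ^ 2)
    (eD1 : D1 = (x ^ 4 - 4 * b * x ^ 3 + 6 * b * x ^ 2 - 4 * b * x + b ^ 2)
      + (x - b) * (4 * x ^ 3 - 12 * b * x ^ 2 + 12 * b * x - 4 * b))
    (eG1 : G1 = 2 * x * B * S + A * (2 * x - 2) * S
      + A * B * (20 * x ^ 3 - 3 * (8 * b + 6) * x ^ 2 + 24 * b * x - 2 * b)) :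
    b * (b - 1) * (G1 * D - 2 * (A * B * S) * D1) / D ^ 3 =
    (1 / 2) * (1 / (-((b - 1) * x * A ^ 2) / D) + 1 / (-(b * (x - 1) * B ^ 2) / D)
        + 1 / (-(x * (x - 1) * C ^ 2) / D)) * (b * (b - 1) * (A * B * S) / D ^ 2) ^ 2
      - (1 / x + 1 / (x - 1) + 1 / (-(x * (x - 1) * C ^ 2) / D))
        * (b * (b - 1) * (A * B * S) / D ^ 2)
      + ((-((b - 1) * x * A ^ 2) / D) * (-(b * (x - 1) * B ^ 2) / D)
          * (-(x * (x - 1) * C ^ 2) / D) / (x ^ 2 * (x - 1) ^ 2)) *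
        (9 / 2 + 1 / 2 * x * (x - 1) / (-(x * (x - 1) * C ^ 2) / D) ^ 2) := by
  have h1 : (1 : ℂ) / (-((b - 1) * x * A ^ 2) / D) = - (D / ((b - 1) * x * A ^ 2)) := by
    field_simp
  have h2 : (1 : ℂ) / (-(b * (x - 1) * B ^ 2) / D) = - (D / (b * (x - 1) * B ^ 2)) := by
    field_simp
  have h3 : (1 : ℂ) / (-(x * (x - 1) * C ^ 2) / D) = - (D / (x * (x - 1) * C ^ 2)) := by
    field_simp
  rw [h1, h2, h3]
  field_simp
  subst eG1
  subst eA eB eC eD eS eD1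
  ring

theorem p6_poly_deriv (b x : ℂ) :
    HasDerivAt (fun x : ℂ => (x - b) * (x ^ 4 - 4 * b * x ^ 3 + 6 * b * x ^ 2 - 4 * b * x + b ^ 2))
      ((x ^ 4 - 4 * b * x ^ 3 + 6 * b * x ^ 2 - 4 * b * x + b ^ 2)
      + (x - b) * (4 * x ^ 3 - 12 * b * x ^ 2 + 12 * b * x - 4 * b)) x := by
  have h := ((hasDerivAt_id x).sub_const b).mul
    ((((((hasDerivAt_pow 4 x).sub ((hasDerivAt_pow 3 x).const_mul (4 * b))).add
      ((hasDerivAt_pow 2 x).const_mul (6 * b))).sub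
      ((hasDerivAt_id x).const_mul (4 * b)))).add_const (b ^ 2))
  refine (h.congr_deriv ?_)
  simp only [Pi.add_apply, Pi.sub_apply, id]
  push_cast
  ring

theorem p6_num_deriv (b x : ℂ) :
    HasDerivAt (fun x : ℂ => -(x * (b - 1) * (x ^ 2 - b) ^ 2))
      (-((b - 1) * (5 * x ^ 4 - 6 * b * x ^ 2 + b ^ 2))) x := by
  have h := (((hasDerivAt_id x).mul_const (b - 1)).mul
    (((hasDerivAt_pow 2 x).sub_const b).pow 2)).neg
  refine (h.congr_deriv ?_)
  simp
  ring

theorem p6_g_deriv (b x : ℂ) :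
    HasDerivAt (fun x : ℂ => (x ^ 2 - b) * (x ^ 2 - 2 * x + b) *
        (5 * x ^ 4 - (8 * b + 6) * x ^ 3 + 12 * b * x ^ 2 - 2 * b * x - b ^ 2))
      (2 * x * (x ^ 2 - 2 * x + b)
          * (5 * x ^ 4 - (8 * b + 6) * x ^ 3 + 12 * b * x ^ 2 - 2 * b * x - b ^ 2)
        + (x ^ 2 - b) * (2 * x - 2)
          * (5 * x ^ 4 - (8 * b + 6) * x ^ 3 + 12 * b * x ^ 2 - 2 * b * x - b ^ 2)
        + (x ^ 2 - b) * (x ^ 2 - 2 * x + b)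
          * (20 * x ^ 3 - 3 * (8 * b + 6) * x ^ 2 + 24 * b * x - 2 * b)) x := by
  have h := (((hasDerivAt_pow 2 x).sub_const b).mul
    (((hasDerivAt_pow 2 x).sub ((hasDerivAt_id x).const_mul 2)).add_const b)).mul
    ((((((hasDerivAt_pow 4 x).const_mul 5).sub ((hasDerivAt_pow 3 x).const_mul (8 * b + 6))).add
      ((hasDerivAt_pow 2 x).const_mul (12 * b))).sub
      ((hasDerivAt_id x).const_mul (2 * b))).sub_const (b ^ 2))
  refine (h.congr_deriv ?_)
  simp
  ring


/-- The Painlevé VI equation with parameters (α,β,γ,δ), as a pointwise condition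
on a function y at the point x. -/
def PainleveVI (α β γ δ : ℂ) (y : ℂ → ℂ) (x : ℂ) : Prop :=
  deriv (deriv y) x =
    (1 / 2) * (1 / y x + 1 / (y x - 1) + 1 / (y x - x)) * (deriv y x) ^ 2
      - (1 / x + 1 / (x - 1) + 1 / (y x - x)) * deriv y x
      + (y x * (y x - 1) * (y x - x) / (x ^ 2 * (x - 1) ^ 2)) *
        (α + β * x / (y x) ^ 2 + γ * (x - 1) / (y x - 1) ^ 2
          + δ * x * (x - 1) / (y x - x) ^ 2)

/-- y(x) = −x(b−1)(x²−b)²/[(x−b)(x⁴−4bx³+6bx²−4bx+b²)] satisfies Painlevé VI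
with (α,β,γ,δ) = (9/2,0,0,1/2). -/
theorem stmt_4 (b : ℂ) (hb0 : b ≠ 0) (hb1 : b ≠ 1)
    (y : ℂ → ℂ)
    (hy : y = fun x => -(x * (b - 1) * (x ^ 2 - b) ^ 2) /
      ((x - b) * (x ^ 4 - 4 * b * x ^ 3 + 6 * b * x ^ 2 - 4 * b * x + b ^ 2)))
    (x : ℂ) (hx0 : x ≠ 0) (hx1 : x ≠ 1) (hxb : x ≠ b)
    (hden : x ^ 4 - 4 * b * x ^ 3 + 6 * b * x ^ 2 - 4 * b * x + b ^ 2 ≠ 0)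
    (hy0 : y x ≠ 0) (hy1 : y x - 1 ≠ 0) (hyx : y x - x ≠ 0) :
    PainleveVI (9 / 2) 0 0 (1 / 2) y x := by
  have hDx : (x - b) * (x ^ 4 - 4 * b * x ^ 3 + 6 * b * x ^ 2 - 4 * b * x + b ^ 2) ≠ 0 :=
    mul_ne_zero (sub_ne_zero.2 hxb) hden
  have hd : ∀ z : ℂ,
      (z - b) * (z ^ 4 - 4 * b * z ^ 3 + 6 * b * z ^ 2 - 4 * b * z + b ^ 2) ≠ 0 →
      deriv y z = b * (b - 1) * ((z ^ 2 - b) * (z ^ 2 - 2 * z + b) *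
        (5 * z ^ 4 - (8 * b + 6) * z ^ 3 + 12 * b * z ^ 2 - 2 * b * z - b ^ 2)) /
        ((z - b) * (z ^ 4 - 4 * b * z ^ 3 + 6 * b * z ^ 2 - 4 * b * z + b ^ 2)) ^ 2 := by
    intro z hz
    rw [hy]
    refine (((p6_num_deriv b z).div (p6_poly_deriv b z) hz).congr_deriv ?_).deriv
    congr 1
    ring
  have hev : deriv y =ᶠ[nhds x] fun z => b * (b - 1) * ((z ^ 2 - b) * (z ^ 2 - 2 * z + b) *
        (5 * z ^ 4 - (8 * b + 6) * z ^ 3 + 12 * b * z ^ 2 - 2 * b * z - b ^ 2)) /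
        ((z - b) * (z ^ 4 - 4 * b * z ^ 3 + 6 * b * z ^ 2 - 4 * b * z + b ^ 2)) ^ 2 := by
    filter_upwards [(p6_poly_deriv b x).continuousAt.eventually_ne hDx] with z hz
    exact hd z hz
  have hdd := (((p6_g_deriv b x).const_mul (b * (b - 1))).div
    ((p6_poly_deriv b x).pow 2) (pow_ne_zero 2 hDx)).deriv
  have hdd2 := hev.deriv_eq.trans hdd
  have e0 : y x = -((b - 1) * x * (x ^ 2 - b) ^ 2) /
      ((x - b) * (x ^ 4 - 4 * b * x ^ 3 + 6 * b * x ^ 2 - 4 * b * x + b ^ 2)) := by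
    rw [hy]; ring
  have e1 : y x - 1 = -(b * (x - 1) * (x ^ 2 - 2 * x + b) ^ 2) /
      ((x - b) * (x ^ 4 - 4 * b * x ^ 3 + 6 * b * x ^ 2 - 4 * b * x + b ^ 2)) := by
    rw [e0, div_sub_one hDx]; congr 1; ring
  have e2 : y x - x = -(x * (x - 1) * (x ^ 2 - 2 * b * x + b) ^ 2) /
      ((x - b) * (x ^ 4 - 4 * b * x ^ 3 + 6 * b * x ^ 2 - 4 * b * x + b ^ 2)) := by
    rw [e0, div_sub' hDx]; congr 1; ring
  have hA : x ^ 2 - b ≠ 0 := by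
    intro h; apply hy0; rw [e0, h]; simp
  have hB : x ^ 2 - 2 * x + b ≠ 0 := by
    intro h; apply hy1; rw [e1, h]; simp
  have hC : x ^ 2 - 2 * b * x + b ≠ 0 := by
    intro h; apply hyx; rw [e2, h]; simp
  have key := p6_alg b x _ _ _ _ _ _ _ hb0 (sub_ne_zero.2 hb1) hx0 (sub_ne_zero.2 hx1) hA hB hC
    hDx rfl rfl rfl rfl rfl rfl rfl
  unfold PainleveVI
  rw [hdd2, e1, e2, hd x hDx, e0]
  simp only [zero_mul, zero_div, add_zero]
  rw [← key]
  simp only [Pi.pow_apply]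
  generalize (x - b) * (x ^ 4 - 4 * b * x ^ 3 + 6 * b * x ^ 2 - 4 * b * x + b ^ 2) = D at hDx ⊢
  field_simp
  push_cast
  ring
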